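/- Let L be a non-degenerate even lattice of signature (p,2) with p ≥ 3 whose discriminant group A = L'/L is anisotropic and has odd level. Then L splits a hyperbolic plane over ℤ, i.e. L ≅ K ⊕ U for some even lattice K, where U is the hyperbolic plane. -/

import Mathlib

lemma leg_pigeon (a b c : ℕ) (ha : 0 < a) (hb : 0 < b) (hc : 0 < c) (k l m : ℤ) :
    ∃ x y z : ℤ, (x ≠ 0 ∨ y ≠ 0 ∨ z ≠ 0) ∧ x ^ 2 ≤ b * c ∧ y ^ 2 ≤ a * c ∧ z ^ 2 ≤ a * b ∧
      (a : ℤ) ∣ y - k * z ∧ (b : ℤ) ∣ x - l * z ∧ (c : ℤ) ∣ x - m * y := by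
  have : NeZero a := ⟨ha.ne'⟩
  have : NeZero b := ⟨hb.ne'⟩
  have : NeZero c := ⟨hc.ne'⟩
  set s1 := Nat.sqrt (b * c) with hs1
  set s2 := Nat.sqrt (a * c) with hs2
  set s3 := Nat.sqrt (a * b) with hs3
  have e1 : b * c < (s1 + 1) * (s1 + 1) := Nat.lt_succ_sqrt _
  have e2 : a * c < (s2 + 1) * (s2 + 1) := Nat.lt_succ_sqrt _
  have e3 : a * b < (s3 + 1) * (s3 + 1) := Nat.lt_succ_sqrt _
  have hcard : a * (b * c) < (s1 + 1) * ((s2 + 1) * (s3 + 1)) := by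
    have h := Nat.mul_lt_mul'' (Nat.mul_lt_mul'' e1 e2) e3
    by_contra hcon
    push Not at hcon
    have := Nat.mul_le_mul hcon hcon
    nlinarith
  let S : Finset (ℕ × ℕ × ℕ) :=
    Finset.range (s1 + 1) ×ˢ (Finset.range (s2 + 1) ×ˢ Finset.range (s3 + 1))
  let f : ℕ × ℕ × ℕ → ZMod a × ZMod b × ZMod c := fun t =>
    ((t.2.1 : ZMod a) - k * t.2.2, (t.1 : ZMod b) - l * t.2.2, (t.1 : ZMod c) - m * t.2.1)
  obtain ⟨t, ht, u, hu, hne, hf⟩ := Finset.exists_ne_map_eq_of_card_lt_of_maps_to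
    (s := S) (t := Finset.univ) (f := f) (by
      simp only [S, Finset.card_product, Finset.card_range, Finset.card_univ, Fintype.card_prod,
        ZMod.card]
      exact hcard) (fun _ _ => Finset.mem_coe.2 (Finset.mem_univ _))
  simp only [S, Finset.mem_product, Finset.mem_range] at ht hu
  simp only [f, Prod.mk.injEq] at hf
  obtain ⟨f1, f2, f3⟩ := hf
  have bd : ∀ (p q s N : ℕ), p < s + 1 → q < s + 1 → s * s ≤ N → ((p : ℤ) - q) ^ 2 ≤ N := by
    intro p q s N h1 h2 h3
    have : (p : ℤ) ≤ s := by omega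
    have : (q : ℤ) ≤ s := by omega
    have : (s : ℤ) * s ≤ N := by exact_mod_cast h3
    nlinarith
  refine ⟨(t.1 : ℤ) - u.1, (t.2.1 : ℤ) - u.2.1, (t.2.2 : ℤ) - u.2.2, ?_, ?_, ?_, ?_, ?_, ?_, ?_⟩
  · by_contra hcon
    push Not at hcon
    apply hne
    ext
    · have := hcon.1; omega
    · have := hcon.2.1; omega
    · have := hcon.2.2; omega
  · exact_mod_cast bd _ _ _ _ ht.1 hu.1 (Nat.sqrt_le (b * c))
  · exact_mod_cast bd _ _ _ _ ht.2.1 hu.2.1 (Nat.sqrt_le (a * c))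
  · exact_mod_cast bd _ _ _ _ ht.2.2 hu.2.2 (Nat.sqrt_le (a * b))
  · rw [← ZMod.intCast_zmod_eq_zero_iff_dvd]
    push_cast
    linear_combination f1
  · rw [← ZMod.intCast_zmod_eq_zero_iff_dvd]
    push_cast
    linear_combination f2
  · rw [← ZMod.intCast_zmod_eq_zero_iff_dvd]
    push_cast
    linear_combination f3

lemma leg_pos (a b c : ℕ) (ha : 0 < a) (hb : 0 < b) (hc : 0 < c)
    (hab : IsCoprime (a : ℤ) b) (hac : IsCoprime (a : ℤ) c) (hbc : IsCoprime (b : ℤ) c)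
    (k l m : ℤ) (hk : (a : ℤ) ∣ b * k ^ 2 - c) (hl : (b : ℤ) ∣ a * l ^ 2 - c)
    (hm : (c : ℤ) ∣ a * m ^ 2 + b)
    (h1 : ¬ IsSquare ((a : ℤ) * b)) (h2 : ¬ IsSquare ((b : ℤ) * c)) :
    ∃ x y z : ℤ, (x ≠ 0 ∨ y ≠ 0 ∨ z ≠ 0) ∧ (a : ℤ) * x ^ 2 + b * y ^ 2 = c * z ^ 2 := by
  obtain ⟨x, y, z, hne, bx, byy, bz, da, db, dc⟩ := leg_pigeon a b c ha hb hc k l m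
  have ha' : (0 : ℤ) < a := by exact_mod_cast ha
  have hb' : (0 : ℤ) < b := by exact_mod_cast hb
  have hc' : (0 : ℤ) < c := by exact_mod_cast hc
  have bx' : x ^ 2 < b * c := lt_of_le_of_ne bx fun h => h2 ⟨x, by rw [← h]; ring⟩
  have bz' : z ^ 2 < a * b := lt_of_le_of_ne bz fun h => h1 ⟨z, by rw [← h]; ring⟩
  have ea : (a : ℤ) ∣ a * x ^ 2 + b * y ^ 2 - c * z ^ 2 := by
    obtain ⟨r, hr⟩ := da
    obtain ⟨s, hs⟩ := hk
    exact ⟨x ^ 2 + b * (r * (y + k * z)) + s * z ^ 2, by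
      linear_combination (b : ℤ) * (y + k * z) * hr + z ^ 2 * hs⟩
  have eb : (b : ℤ) ∣ a * x ^ 2 + b * y ^ 2 - c * z ^ 2 := by
    obtain ⟨r, hr⟩ := db
    obtain ⟨s, hs⟩ := hl
    exact ⟨y ^ 2 + a * (r * (x + l * z)) + s * z ^ 2, by
      linear_combination (a : ℤ) * (x + l * z) * hr + z ^ 2 * hs⟩
  have ec : (c : ℤ) ∣ a * x ^ 2 + b * y ^ 2 - c * z ^ 2 := by
    obtain ⟨r, hr⟩ := dc
    obtain ⟨s, hs⟩ := hm
    exact ⟨- z ^ 2 + a * (r * (x + m * y)) + s * y ^ 2, by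
      linear_combination (a : ℤ) * (x + m * y) * hr + y ^ 2 * hs⟩
  have eabc : (a : ℤ) * b * c ∣ a * x ^ 2 + b * y ^ 2 - c * z ^ 2 :=
    (IsCoprime.mul_left hac hbc).mul_dvd (hab.mul_dvd ea eb) ec
  obtain ⟨t, ht⟩ := eabc
  have hP : (0 : ℤ) < a * b * c := by positivity
  have u1 : (a : ℤ) * b * c * t < a * b * c * 2 := by
    rw [← ht]
    nlinarith [mul_lt_mul_of_pos_left bx' ha', mul_le_mul_of_nonneg_left byy hb'.le,
      mul_nonneg hc'.le (sq_nonneg z)]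
  have u2 : (a : ℤ) * b * c * (-1) < a * b * c * t := by
    rw [← ht]
    nlinarith [mul_lt_mul_of_pos_left bz' hc', mul_nonneg ha'.le (sq_nonneg x),
      mul_nonneg hb'.le (sq_nonneg y)]
  have t1 : t < 2 := lt_of_mul_lt_mul_left u1 hP.le
  have t2 : -1 < t := lt_of_mul_lt_mul_left u2 hP.le
  have : t = 0 ∨ t = 1 := by omega
  rcases this with rfl | rfl
  · exact ⟨x, y, z, hne, by linarith⟩
  · refine ⟨x * z + b * y, y * z - a * x, z ^ 2 + a * b, Or.inr (Or.inr ?_), ?_⟩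
    · have : 0 < z ^ 2 + (a : ℤ) * b := by positivity
      exact this.ne'
    · linear_combination (z ^ 2 + (a : ℤ) * b) * ht

lemma recip_sym (a q : ℕ) (b : ℤ) (ha : Odd a) (hab : ((a : ℤ) * b) % 4 = 3)
    (hcop : IsCoprime (a : ℤ) b)
    (hq : Odd q) (hqa : (a : ℤ) ∣ q - b) (hqb : b ∣ q - a) :
    jacobiSym (-(a * b)) q = 1 := by
  have ha2 : a % 2 = 1 := Nat.odd_iff.1 ha
  have hq2 : q % 2 = 1 := Nat.odd_iff.1 hq
  have b4 : b % 4 = 1 ∧ a % 4 = 3 ∨ b % 4 = 3 ∧ a % 4 = 1 := by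
    have h1 : (a : ℤ) % 4 = 1 ∨ (a : ℤ) % 4 = 3 := by omega
    have h2 : b % 4 = 0 ∨ b % 4 = 1 ∨ b % 4 = 2 ∨ b % 4 = 3 := by omega
    rcases h1 with h1 | h1 <;> rcases h2 with h2 | h2 | h2 | h2 <;>
      simp [Int.mul_emod, h1, h2] at hab ⊢ <;> omega
  have E2 : jacobiSym q a = jacobiSym b a :=
    jacobiSym.mod_left' (Int.modEq_iff_dvd.2 hqa).symm
  have E3 : jacobiSym q b.natAbs = jacobiSym a b.natAbs :=
    jacobiSym.mod_left' (Int.modEq_iff_dvd.2 (by simpa using hqb)).symm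
  have hcop' : Int.gcd (a : ℤ) b.natAbs = 1 := by
    rw [Int.isCoprime_iff_gcd_eq_one] at hcop
    simpa [Int.gcd, Int.natAbs_abs] using hcop
  have E5 := jacobiSym.sq_one hcop'
  have hb2 : b.natAbs % 2 = 1 := by omega
  have hb2' : Odd b.natAbs := Nat.odd_iff.2 hb2
  have R1 := jacobiSym.quadratic_reciprocity_if ha2 hq2
  have R2 := jacobiSym.quadratic_reciprocity_if hb2 hq2
  have R3 := jacobiSym.quadratic_reciprocity_if hb2 ha2
  have q4 : q % 4 = 1 ∨ q % 4 = 3 := by omega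
  rw [E2] at R1
  rw [E3] at R2
  rcases le_total 0 b with hb | hb
  · obtain ⟨β, rfl⟩ := Int.eq_ofNat_of_zero_le hb
    simp only [Int.natAbs_natCast] at *
    rw [jacobiSym.neg _ hq, ZMod.χ₄_nat_eq_if_mod_four, jacobiSym.mul_left, ← R1, ← R2, ← R3]
    rcases b4 with ⟨b4, a4⟩ | ⟨b4, a4⟩ <;> rcases q4 with q4 | q4 <;>
    · have b4' : β % 4 = 1 ∨ β % 4 = 3 := by omega
      have : (β : ℤ) % 4 = (β % 4 : ℕ) := by omega
      rw [this] at b4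
      norm_cast at b4
      simp [a4, b4, q4, ha2, hq2]
      linear_combination E5
  · obtain ⟨β, hβ⟩ := Int.eq_ofNat_of_zero_le (neg_nonneg.2 hb)
    obtain rfl : b = -β := by omega
    simp only [Int.natAbs_neg, Int.natAbs_natCast] at *
    rw [jacobiSym.neg _ ha, ZMod.χ₄_nat_eq_if_mod_four] at R1
    rw [mul_neg, neg_neg, jacobiSym.mul_left, ← R1, ← R2, ← R3]
    rcases b4 with ⟨b4, a4⟩ | ⟨b4, a4⟩ <;> rcases q4 with q4 | q4 <;>
    · have b4' : β % 4 = if a % 4 = 1 then 1 else 3 := by split_ifs <;> omega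
      simp [a4] at b4'
      simp [a4, b4', q4, ha2, hq2]
      linear_combination E5

lemma ternary (a q : ℕ) (b : ℤ) (ha0 : 0 < a) (ha : Odd a) (hab : ((a : ℤ) * b) % 4 = 3)
    (hcop : IsCoprime (a : ℤ) b) (hq2 : Odd q) (hqp : q.Prime)
    (hna : ¬ (q : ℤ) ∣ a) (hnb : ¬ (q : ℤ) ∣ b)
    (hqa : (a : ℤ) ∣ q - b) (hqb : b ∣ q - a) :
    ∃ x y z : ℤ, (x ≠ 0 ∨ y ≠ 0 ∨ z ≠ 0) ∧ (a : ℤ) * x ^ 2 + b * y ^ 2 = q * z ^ 2 := by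
  have hj := recip_sym a q b ha hab hcop hq2 hqa hqb
  have : Fact q.Prime := ⟨hqp⟩
  have hqp' : Prime (q : ℤ) := Nat.prime_iff_prime_int.1 hqp
  have hsq := ZMod.isSquare_of_jacobiSym_eq_one hj
  have caq : IsCoprime (a : ℤ) q := ((hqp'.coprime_iff_not_dvd).2 hna).symm
  have cbq : IsCoprime b (q : ℤ) := ((hqp'.coprime_iff_not_dvd).2 hnb).symm
  obtain ⟨s', hs'⟩ := hsq
  obtain ⟨s, rfl⟩ := ZMod.intCast_surjective s'
  have hs : (q : ℤ) ∣ a * b + s * s := by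
    rw [← ZMod.intCast_zmod_eq_zero_iff_dvd]
    push_cast at hs' ⊢
    rw [← hs']; ring
  have nsq : ∀ r : ℤ, ¬ (q : ℤ) ∣ r → ¬ IsSquare (q * r) := by
    rintro r hr ⟨t, ht⟩
    have h1 : (q : ℤ) ∣ t := by
      have : (q : ℤ) ∣ t * t := ⟨r, ht.symm⟩
      exact (hqp'.dvd_or_dvd this).elim id id
    obtain ⟨w, rfl⟩ := h1
    apply hr
    exact ⟨w * w, mul_left_cancel₀ hqp'.ne_zero (by linear_combination ht)⟩
  obtain ⟨u, v, huv⟩ := caq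
  obtain ⟨u', v', huv'⟩ := cbq
  have b0 : b ≠ 0 := by rintro rfl; simp at hab
  rcases lt_or_gt_of_ne b0 with hb | hb
  · obtain ⟨β, hβ⟩ : ∃ β : ℕ, b = -β := ⟨b.natAbs, by omega⟩
    subst hβ
    have hβ0 : 0 < β := by omega
    have hnb' : ¬ (q : ℤ) ∣ β := by rwa [Int.dvd_neg] at hnb
    obtain ⟨x, y, z, hne, h⟩ := leg_pos β q a hβ0 hqp.pos ha0 (by
        simpa using ((hqp'.coprime_iff_not_dvd).2 hnb').symm) (by rw [← IsCoprime.neg_left_iff]; exact hcop.symm)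
        ((hqp'.coprime_iff_not_dvd).2 hna) 1 (s * u') 1
        (by rw [neg_dvd] at hqb; simpa using hqb)
        (by
          obtain ⟨r, hr⟩ := hs
          refine ⟨r * β * u' ^ 2 + a * (β * u' - 1) * v', ?_⟩
          linear_combination (β : ℤ) * u' ^ 2 * hr - (a : ℤ) * (β * u' - 1) * huv')
        (by simpa [add_comm] using hqa)
        (by rw [mul_comm]; exact nsq _ hnb') (nsq _ hna)
    exact ⟨z, x, y, by tauto, by push_cast; linear_combination - h⟩
  · obtain ⟨β, hβ⟩ : ∃ β : ℕ, b = β := ⟨b.natAbs, by omega⟩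
    subst hβ
    have hβ0 : 0 < β := by omega
    obtain ⟨x, y, z, hne, h⟩ := leg_pos a β q ha0 hβ0 hqp.pos hcop
        ((hqp'.coprime_iff_not_dvd).2 hna).symm ((hqp'.coprime_iff_not_dvd).2 hnb).symm
        1 1 (s * u)
        (by have := (dvd_neg (a := (a : ℤ))).2 hqa; simpa using this)
        (by have := (dvd_neg (a := (β : ℤ))).2 hqb; simpa using this)
        (by
          obtain ⟨r, hr⟩ := hs
          refine ⟨r * a * u ^ 2 + β * (1 + u * a) * v, ?_⟩
          linear_combination (a : ℤ) * u ^ 2 * hr - (β : ℤ) * (1 + u * a) * huv)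
        (by
          rintro ⟨t, ht⟩
          rw [ht] at hab
          have : t % 4 = 0 ∨ t % 4 = 1 ∨ t % 4 = 2 ∨ t % 4 = 3 := by omega
          rcases this with h | h | h | h <;> simp [Int.mul_emod, h] at hab)
        (by rw [mul_comm]; exact nsq _ hnb)
    exact ⟨x, y, z, hne, h⟩

lemma quaternary (a b c e : ℤ) (ha : 0 < a) (he : e < 0) (hab : (a * b) % 4 = 3)
    (hce : (c * e) % 4 = 3) (cab : IsCoprime a b) (cac : IsCoprime a c) (cae : IsCoprime a e)
    (cbc : IsCoprime b c) (cbe : IsCoprime b e) (cce : IsCoprime c e) :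
    ∃ q x y z x' y' z' : ℤ, q ≠ 0 ∧ (x ≠ 0 ∨ y ≠ 0 ∨ z ≠ 0) ∧ (x' ≠ 0 ∨ y' ≠ 0 ∨ z' ≠ 0) ∧
      a * x ^ 2 + b * y ^ 2 = q * z ^ 2 ∧ c * x' ^ 2 + e * y' ^ 2 = - (q * z' ^ 2) := by
  obtain ⟨A, rfl⟩ := Int.eq_ofNat_of_zero_le ha.le
  obtain ⟨E, hE⟩ := Int.eq_ofNat_of_zero_le (neg_nonneg.2 he.le)
  obtain rfl : e = -E := by omega
  have b0 : b ≠ 0 := by rintro rfl; simp at hab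
  have c0 : c ≠ 0 := by rintro rfl; simp at hce
  have crt : ∀ (m n r s : ℤ), IsCoprime m n → ∃ t, m ∣ t - r ∧ n ∣ t - s := by
    rintro m n r s ⟨u, v, h⟩
    exact ⟨r * v * n + s * u * m, ⟨(s - r) * u, by linear_combination r * h⟩,
      ⟨(r - s) * v, by linear_combination s * h⟩⟩
  obtain ⟨r1, h1, h2⟩ := crt A b b A cab
  obtain ⟨r2, h3, h4⟩ := crt c (-E) E (-c) cce
  have cABCE : IsCoprime ((A : ℤ) * b) (c * (-E)) :=
    (cac.mul_right cae).mul_left (cbc.mul_right cbe)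
  obtain ⟨r, h5, h6⟩ := crt _ _ r1 r2 cABCE
  have cong : ∀ m t s : ℤ, m ∣ t - s → ∀ u, IsCoprime s u → u = m → IsCoprime t m := by
    rintro m t s ⟨k, hk⟩ u ⟨α, β, h⟩ rfl
    exact ⟨α, β - α * k, by linear_combination h + α * hk⟩
  have tr : ∀ m m' t s w : ℤ, m ∣ m' → m' ∣ t - s → m ∣ s - w → m ∣ t - w := by
    intro m m' t s w h h' h''
    have := dvd_add (h.trans h') h''
    simpa using this
  have g1 := tr A _ _ _ _ ⟨b, rfl⟩ h5 h1
  have g2 := tr b _ _ _ _ ⟨A, mul_comm _ _⟩ h5 h2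
  have g3 := tr c _ _ _ _ ⟨-E, rfl⟩ h6 h3
  have g4 := tr (-E) _ _ _ _ ⟨c, mul_comm _ _⟩ h6 h4
  have cr : IsCoprime r ((A * b) * (c * (-E))) := by
    refine ((cong _ _ _ g1 _ cab.symm rfl).mul_right (cong _ _ _ g2 _ cab rfl)).mul_right
      ((cong _ _ _ g3 _ ?_ rfl).mul_right (cong _ _ _ g4 _ ?_ rfl))
    · have := cce.symm.neg_left
      rwa [neg_neg] at this
    · exact (IsCoprime.neg_left_iff _ _).2 cce
  set M : ℤ := (A * b) * (c * (-E)) with hM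
  have hM0 : M ≠ 0 := by
    rw [hM]
    refine mul_ne_zero (mul_ne_zero (by omega) b0) (mul_ne_zero c0 (by omega))
  obtain ⟨q, hqgt, hqp, hqr⟩ := Nat.forall_exists_prime_gt_and_zmodEq (M.natAbs + 2)
    (q := M.natAbs) (a := r) (by simpa using hM0) (by
      rw [Int.isCoprime_iff_gcd_eq_one] at cr ⊢
      simpa [Int.gcd, Int.natAbs_abs] using cr)
  have hMq : M ∣ q - r := by
    have := hqr.symm.dvd
    simpa using this
  have f1 := tr A _ _ _ _ ⟨b * (c * (-E)), by rw [hM]; ring⟩ hMq g1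
  have f2 := tr b _ _ _ _ ⟨A * (c * (-E)), by rw [hM]; ring⟩ hMq g2
  have f3 := tr c _ _ _ _ ⟨A * b * (-E), by rw [hM]; ring⟩ hMq g3
  have f4 := tr (-E) _ _ _ _ ⟨A * b * c, by rw [hM]; ring⟩ hMq g4
  have ndvd : ∀ t : ℤ, t ∣ M → ¬ (q : ℤ) ∣ t := by
    intro t ht h
    have h1 := h.trans ht
    have h2 := Int.le_of_dvd (Int.natAbs_pos.2 hM0 |> fun h => by positivity) ((dvd_abs _ _).2 h1)
    rw [Int.abs_eq_natAbs] at h2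
    omega
  have hq2 : Odd q := hqp.odd_of_ne_two (by omega)
  have oddA : Odd A := by
    rw [Nat.odd_iff]
    by_contra h
    have h' : (A : ℤ) % 2 = 0 := by omega
    have : ((A : ℤ) * b) % 2 = 0 := by simp [Int.mul_emod, h']
    omega
  have oddE : Odd E := by
    rw [Nat.odd_iff]
    by_contra h
    have h' : (-E : ℤ) % 2 = 0 := by omega
    have : (c * (-E : ℤ)) % 2 = 0 := by rw [Int.mul_emod, h']; simp
    omega
  obtain ⟨x, y, z, hn, hxyz⟩ := ternary A q b (by omega) oddA hab cab hq2 hqp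
    (ndvd _ ⟨b * (c * (-E)), by rw [hM]; ring⟩) (ndvd _ ⟨A * (c * (-E)), by rw [hM]; ring⟩) f1 f2
  obtain ⟨x', y', z', hn', hxyz'⟩ := ternary E q (-c) (by omega) oddE
    (by rw [← hce]; congr 1; ring) (by
      have := cce.symm.neg_left
      rw [neg_neg] at this
      exact this.neg_right) hq2 hqp
    (ndvd _ ⟨-(A * b * c), by rw [hM]; ring⟩) (ndvd _ ⟨A * b * E, by rw [hM]; ring⟩)
    (by simpa using f4) (by simpa using f3)
  exact ⟨q, x, y, z, y', x', z', by exact_mod_cast hqp.ne_zero, hn, by tauto, hxyz,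
    by linear_combination - hxyz'⟩
open Module

/-- Reduction of an integer vector modulo `l`. -/
def redv {n : ℕ} (l : ℕ) (v : Fin n → ℤ) : Fin n → ZMod l := fun i => (v i : ZMod l)

lemma redv_add {n l : ℕ} (v w : Fin n → ℤ) : redv l (v + w) = redv l v + redv l w := by
  ext i; simp [redv]

lemma redv_smul {n l : ℕ} (c : ℤ) (w : Fin n → ℤ) :
    redv l (c • w) = (c : ZMod l) • redv l w := by
  ext i; simp [redv]

lemma redv_sum {n l : ℕ} {ι : Type*} (s : Finset ι) (c : ι → ℤ) (w : ι → Fin n → ℤ) :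
    redv l (∑ j ∈ s, c j • w j) = ∑ j ∈ s, (c j : ZMod l) • redv l (w j) := by
  ext i; simp [redv, Finset.sum_apply]

lemma redv_eq_zero {n l : ℕ} (v : Fin n → ℤ) (h : redv l v = 0) :
    ∃ u : Fin n → ℤ, v = (l : ℤ) • u := by
  have : ∀ i, ∃ t, v i = l * t := by
    intro i
    have := congrFun h i
    simp only [redv, Pi.zero_apply] at this
    exact (ZMod.intCast_zmod_eq_zero_iff_dvd _ _).1 this
  choose u hu using this
  exact ⟨u, by ext i; simp [hu]⟩

lemma redv_surj {n l : ℕ} (v : Fin n → ZMod l) : ∃ u : Fin n → ℤ, redv l u = v := by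
  have : ∀ i, ∃ t : ℤ, (t : ZMod l) = v i := fun i => ZMod.intCast_surjective _
  choose u hu using this
  exact ⟨u, by ext i; simp [redv, hu]⟩

/-- The bilinear form of an integer Gram matrix. -/
noncomputable def BB {n : ℕ} (G : Matrix (Fin n) (Fin n) ℤ) :
    (Fin n → ℤ) →ₗ[ℤ] (Fin n → ℤ) →ₗ[ℤ] ℤ := Matrix.toLinearMap₂' ℤ G

/-- The reduction of the bilinear form. -/
noncomputable def BR {n : ℕ} (l : ℕ) (G : Matrix (Fin n) (Fin n) ℤ) :
    (Fin n → ZMod l) →ₗ[ZMod l] (Fin n → ZMod l) →ₗ[ZMod l] ZMod l :=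
  Matrix.toLinearMap₂' (ZMod l) (G.map (Int.cast : ℤ → ZMod l))

lemma BB_apply {n : ℕ} (G : Matrix (Fin n) (Fin n) ℤ) (x y : Fin n → ℤ) :
    BB G x y = dotProduct x (G.mulVec y) := Matrix.toLinearMap₂'_apply' _ _ _

lemma BR_redv {n l : ℕ} (G : Matrix (Fin n) (Fin n) ℤ) (x y : Fin n → ℤ) :
    BR l G (redv l x) (redv l y) = (BB G x y : ZMod l) := by
  rw [BB_apply, BR, Matrix.toLinearMap₂'_apply']
  simp [dotProduct, Matrix.mulVec, redv]

lemma dim_red {n i : ℕ} (l : ℕ) [Fact l.Prime] (f : (Fin n → ℤ) →ₗ[ℤ] (Fin i → ℤ)) :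
    n ≤ i + finrank (ZMod l) (Submodule.span (ZMod l) (redv l '' (LinearMap.ker f : Set (Fin n → ℤ)))) := by
  have hl : (l : ℤ) ≠ 0 := by exact_mod_cast (Fact.out : l.Prime).ne_zero
  let b := Module.finBasis ℤ (LinearMap.ker f)
  have h1 : finrank ℤ (LinearMap.range f) + finrank ℤ (LinearMap.ker f) = n := by
    have h := Submodule.finrank_quotient_add_finrank (LinearMap.ker f)
    rw [finrank_fin_fun, f.quotKerEquivRange.finrank_eq] at h
    exact h
  have h2 : finrank ℤ (LinearMap.range f) ≤ i := by
    have h := Submodule.finrank_le (LinearMap.range f)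
    rw [finrank_fin_fun] at h
    exact h
  have hli : LinearIndependent (ZMod l) (fun j => redv l (b j : Fin n → ℤ)) := by
    rw [Fintype.linearIndependent_iff]
    intro g hg
    have : ∀ j, ∃ c : ℤ, (c : ZMod l) = g j := fun j => ZMod.intCast_surjective _
    choose c hc using this
    have h3 : redv l (∑ j, c j • (b j : Fin n → ℤ)) = 0 := by
      rw [redv_sum, ← hg]; simp [hc]
    obtain ⟨u, hu⟩ := redv_eq_zero _ h3
    have hker : u ∈ LinearMap.ker f := by
      have h4 : (∑ j, c j • (b j : Fin n → ℤ)) ∈ LinearMap.ker f :=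
        Submodule.sum_mem _ fun j _ => Submodule.smul_mem _ _ (b j).2
      rw [hu, LinearMap.mem_ker, map_smul] at h4
      exact (smul_eq_zero.1 h4).resolve_left hl
    have h5 : (∑ j, c j • b j) = (l : ℤ) • (⟨u, hker⟩ : LinearMap.ker f) := by
      apply Subtype.ext
      simpa using hu
    intro j
    have h6 := congrArg (fun z => b.repr z j) h5
    simp only [map_smul, Finsupp.smul_apply, Basis.repr_sum_self, smul_eq_mul] at h6
    rw [← hc, h6]; simp
  have h7 := finrank_span_eq_card hli
  have h8 : finrank (ZMod l) (Submodule.span (ZMod l)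
      (Set.range fun j => redv l (b j : Fin n → ℤ))) ≤ finrank (ZMod l)
      (Submodule.span (ZMod l) (redv l '' (LinearMap.ker f : Set (Fin n → ℤ)))) := by
    apply Submodule.finrank_mono
    apply Submodule.span_mono
    rintro _ ⟨j, rfl⟩
    exact ⟨_, (b j).2, rfl⟩
  simp at h7
  omega

lemma dim_orth {n i : ℕ} (l : ℕ) [Fact l.Prime] (G : Matrix (Fin n) (Fin n) ℤ)
    (f : (Fin n → ℤ) →ₗ[ℤ] (Fin i → ℤ)) (W : Submodule (ZMod l) (Fin n → ZMod l))
    (hW : ∀ w ∈ W, ∀ v, f v = 0 → BR l G w (redv l v) = 0) :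
    finrank (ZMod l) W ≤ i + finrank (ZMod l) (LinearMap.ker (BR l G)) := by
  set M := Submodule.span (ZMod l) (redv l '' (LinearMap.ker f : Set (Fin n → ℤ))) with hM
  have hd : n ≤ i + finrank (ZMod l) M := dim_red l f
  let T := (BR l G).domRestrict W
  have h1 := LinearMap.finrank_range_add_finrank_ker T
  have h2 : finrank (ZMod l) (LinearMap.range T) ≤ finrank (ZMod l) M.dualAnnihilator := by
    apply Submodule.finrank_mono
    rintro _ ⟨w, rfl⟩
    rw [Submodule.mem_dualAnnihilator]
    intro v hv
    induction hv using Submodule.span_induction with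
    | mem x h => obtain ⟨y, hy, rfl⟩ := h; exact hW _ w.2 _ hy
    | zero => simp
    | add x y _ _ h1 h2 => rw [map_add, h1, h2, add_zero]
    | smul c x _ h => rw [map_smul, h, smul_zero]
  have h3 : finrank (ZMod l) M + finrank (ZMod l) M.dualAnnihilator = n := by
    simpa using Subspace.finrank_add_finrank_dualAnnihilator_eq M
  have h4 : finrank (ZMod l) (LinearMap.ker T) ≤ finrank (ZMod l) (LinearMap.ker (BR l G)) := by
    let ι : LinearMap.ker T →ₗ[ZMod l] LinearMap.ker (BR l G) :=
      LinearMap.codRestrict _ (W.subtype ∘ₗ (LinearMap.ker T).subtype) (fun x => x.2)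
    apply LinearMap.finrank_le_finrank_of_injective (f := ι)
    intro x y hxy
    apply Subtype.ext
    apply Subtype.ext
    exact congrArg (fun z : LinearMap.ker (BR l G) => (z : Fin n → ZMod l)) hxy
  omega

lemma exists_unit_value {n i : ℕ} (l : ℕ) [Fact l.Prime] (G : Matrix (Fin n) (Fin n) ℤ)
    (Q : (Fin n → ℤ) → ℤ) (hs : ∀ x y, BB G x y = BB G y x) (hQ : ∀ x, BB G x x = 2 * Q x)
    (x : Fin i → Fin n → ℤ) (horth : ∀ j k, j ≠ k → BB G (x j) (x k) = 0)
    (J : Finset (Fin i)) (hJ : ∀ j ∈ J, ¬ (l : ℤ) ∣ BB G (x j) (x j)) (ρ : ℕ)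
    (hρ : finrank (ZMod l) (LinearMap.ker (BR l G)) ≤ ρ) (hn : 2 * i + ρ < n + J.card) :
    ∃ v, (∀ j, BB G (x j) v = 0) ∧ ¬ (l : ℤ) ∣ Q v := by
  by_contra hcon
  push Not at hcon
  let f : (Fin n → ℤ) →ₗ[ℤ] (Fin i → ℤ) := LinearMap.pi fun j => BB G (x j)
  have hf : ∀ v, f v = 0 ↔ ∀ j, BB G (x j) v = 0 := fun v => by
    rw [funext_iff]; rfl
  set M := Submodule.span (ZMod l) (redv l '' (LinearMap.ker f : Set (Fin n → ℤ))) with hM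
  have hd : n ≤ i + finrank (ZMod l) M := dim_red l f
  let O : Submodule (ZMod l) (Fin n → ZMod l) :=
    { carrier := {w | ∀ v, f v = 0 → BR l G w (redv l v) = 0}
      add_mem' := by
        intro a b ha hb v hv
        rw [map_add, LinearMap.add_apply, ha v hv, hb v hv, add_zero]
      zero_mem' := by intro v _; simp
      smul_mem' := by
        intro c a ha v hv
        rw [map_smul, LinearMap.smul_apply, ha v hv, smul_zero] }
  have hO := dim_orth l G f O (fun w hw => hw)
  have hMO : M ≤ O := by
    rw [hM, Submodule.span_le]
    rintro _ ⟨w, hw, rfl⟩ v hv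
    have hw' : f w = 0 := hw
    rw [BR_redv, ZMod.intCast_zmod_eq_zero_iff_dvd]
    have e1 := hcon v ((hf v).1 hv)
    have e2 := hcon w ((hf w).1 hw')
    have e3 := hcon (w + v) ((hf _).1 (by rw [map_add, hw', hv, add_zero]))
    have e4 : BB G w v = Q (w + v) - Q w - Q v := by
      have := hQ (w + v)
      simp only [map_add, LinearMap.add_apply] at this
      rw [hs v w] at this
      linarith [hQ w, hQ v]
    rw [e4]
    exact dvd_sub (dvd_sub e3 e2) e1
  have hxO : ∀ j, redv l (x j) ∈ O := by
    intro j v hv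
    rw [BR_redv, (hf v).1 hv j]; simp
  let T : O →ₗ[ZMod l] (J → ZMod l) :=
    (LinearMap.pi fun j : J => BR l G (redv l (x j))) ∘ₗ O.subtype
  have hT : ∀ (w : O) (j : J), T w j = BR l G (redv l (x j)) w := fun _ _ => rfl
  have hsurj : LinearMap.range T = ⊤ := by
    rw [LinearMap.range_eq_top]
    intro g
    refine ⟨∑ j : J, (g j / BB G (x j) (x j) : ZMod l) • ⟨redv l (x j), hxO j⟩, ?_⟩
    ext k
    rw [map_sum, Finset.sum_apply, Finset.sum_eq_single k]
    · rw [map_smul, Pi.smul_apply, hT, BR_redv, smul_eq_mul, div_mul_cancel₀]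
      rw [Ne, ZMod.intCast_zmod_eq_zero_iff_dvd]
      exact hJ _ k.2
    · intro j _ hjk
      rw [map_smul, Pi.smul_apply, hT, BR_redv, horth _ _ (fun h => hjk (Subtype.ext h.symm))]
      simp
    · simp
  have h1 := LinearMap.finrank_range_add_finrank_ker T
  rw [hsurj, finrank_top, finrank_fintype_fun_eq_card, Fintype.card_coe] at h1
  have h2 : finrank (ZMod l) M ≤ finrank (ZMod l) (LinearMap.ker T) := by
    let ι : M →ₗ[ZMod l] LinearMap.ker T :=
      LinearMap.codRestrict _ (Submodule.inclusion hMO) (fun m => by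
        rw [LinearMap.mem_ker]
        ext j
        rw [hT]
        have hm : ∀ v ∈ M, BR l G (redv l (x j)) v = 0 := by
          intro v hv
          induction hv using Submodule.span_induction with
          | mem x h => obtain ⟨y, hy, rfl⟩ := h; rw [BR_redv, (hf y).1 hy]; simp
          | zero => simp
          | add x y _ _ h1 h2 => rw [map_add, h1, h2, add_zero]
          | smul c x _ h => rw [map_smul, h, smul_zero]
        exact hm _ m.2)
    apply LinearMap.finrank_le_finrank_of_injective (f := ι)
    intro x y hxy
    apply Subtype.ext
    exact congrArg (fun z : LinearMap.ker T => ((z : O) : Fin n → ZMod l)) hxy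
  omega

lemma mem_ker_BR {n l : ℕ} (G : Matrix (Fin n) (Fin n) ℤ) (v : Fin n → ℤ)
    (h : redv l v ∈ LinearMap.ker (BR l G)) (y : Fin n → ℤ) : (l : ℤ) ∣ BB G v y := by
  rw [← ZMod.intCast_zmod_eq_zero_iff_dvd, ← BR_redv, LinearMap.mem_ker.1 h]
  simp

lemma rad_zero {n l : ℕ} [Fact l.Prime] (G : Matrix (Fin n) (Fin n) ℤ)
    (h : ∀ v, (∀ y, (l : ℤ) ∣ BB G v y) → ∃ w, v = (l : ℤ) • w) :
    finrank (ZMod l) (LinearMap.ker (BR l G)) ≤ 0 := by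
  have : LinearMap.ker (BR l G) = ⊥ := by
    rw [eq_bot_iff]
    intro v hv
    obtain ⟨u, rfl⟩ := redv_surj v
    obtain ⟨w, rfl⟩ := h u (mem_ker_BR G u hv)
    rw [redv_smul]; simp
  rw [this]; simp

lemma rad_two {n l : ℕ} [Fact l.Prime] (hl2 : l ≠ 2) (G : Matrix (Fin n) (Fin n) ℤ)
    (Q : (Fin n → ℤ) → ℤ) (hQ : ∀ x, BB G x x = 2 * Q x)
    (H : ∀ (v : Fin n → ℤ) (m : ℤ), m ≠ 0 → (∀ y, m ∣ BB G v y) → m ^ 2 ∣ Q v → ∃ w, v = m • w) :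
    finrank (ZMod l) (LinearMap.ker (BR l G)) ≤ 2 := by
  by_contra hcon
  have hlp : l.Prime := Fact.out
  have hl : (l : ℤ) ≠ 0 := by exact_mod_cast hlp.ne_zero
  have hlp' : Prime (l : ℤ) := Nat.prime_iff_prime_int.1 hlp
  obtain ⟨r', hr'⟩ := exists_linearIndependent_of_le_finrank
    (R := ZMod l) (M := LinearMap.ker (BR l G)) (n := 3) (by omega)
  have : ∀ j, ∃ u : Fin n → ℤ, redv l u = (r' j : Fin n → ZMod l) := fun j => redv_surj _
  choose r hr using this
  have hrd : ∀ j y, (l : ℤ) ∣ BB G (r j) y := fun j => mem_ker_BR G _ (by rw [hr]; exact (r' j).2)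
  have : ∀ j k, ∃ t, BB G (r j) (r k) = l * t := fun j k => hrd j (r k)
  choose β hβ using this
  let F : MvPolynomial (Fin 3) (ZMod l) :=
    ∑ j, ∑ k, MvPolynomial.C (β j k : ZMod l) * (MvPolynomial.X j * MvPolynomial.X k)
  have hF : F.totalDegree < Fintype.card (Fin 3) := by
    apply lt_of_le_of_lt (b := 2) _ (by simp)
    apply MvPolynomial.totalDegree_finsetSum_le
    intro j _
    apply MvPolynomial.totalDegree_finsetSum_le
    intro k _
    refine (MvPolynomial.totalDegree_mul _ _).trans ?_
    rw [MvPolynomial.totalDegree_C, zero_add]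
    refine (MvPolynomial.totalDegree_mul _ _).trans ?_
    simp
  have hev : ∀ c : Fin 3 → ZMod l, MvPolynomial.eval c F = ∑ j, ∑ k, β j k * (c j * c k) := by
    intro c; simp [F]
  have hdvd := char_dvd_card_solutions l hF
  have h0 : MvPolynomial.eval 0 F = 0 := by rw [hev]; simp
  have hcard : 1 < Fintype.card {x : Fin 3 → ZMod l // MvPolynomial.eval x F = 0} := by
    have hpos : 0 < Fintype.card {x : Fin 3 → ZMod l // MvPolynomial.eval x F = 0} :=
      Fintype.card_pos_iff.2 ⟨⟨0, h0⟩⟩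
    exact lt_of_lt_of_le hlp.one_lt (Nat.le_of_dvd hpos hdvd)
  obtain ⟨⟨c', hc'⟩, hne⟩ := Fintype.exists_ne_of_one_lt_card hcard ⟨0, h0⟩
  rw [hev] at hc'
  have : ∀ j, ∃ u : ℤ, (u : ZMod l) = c' j := fun j => ZMod.intCast_surjective _
  choose c hc using this
  set v := ∑ j, c j • r j with hv
  have hvd : ∀ y, (l : ℤ) ∣ BB G v y := by
    intro y
    rw [hv, map_sum, LinearMap.sum_apply]
    apply Finset.dvd_sum
    intro j _
    rw [map_smul, LinearMap.smul_apply]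
    exact Dvd.dvd.mul_left (hrd j y) _
  have hvQ : (l : ℤ) ^ 2 ∣ Q v := by
    have e1 : BB G v v = l * ∑ j, ∑ k, β j k * (c j * c k) := by
      rw [hv]
      simp only [map_sum, LinearMap.sum_apply, map_smul, LinearMap.smul_apply, hβ, Finset.mul_sum,
        smul_eq_mul]
      rw [Finset.sum_comm]
      refine Finset.sum_congr rfl fun j _ => Finset.sum_congr rfl fun k _ => by ring
    have e2 : (l : ℤ) ∣ ∑ j, ∑ k, β j k * (c j * c k) := by
      rw [← ZMod.intCast_zmod_eq_zero_iff_dvd]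
      push_cast
      simpa [hc] using hc'
    obtain ⟨t, ht⟩ := e2
    have e3 : (l : ℤ) ^ 2 ∣ 2 * Q v := ⟨t, by rw [← hQ, e1, ht]; ring⟩
    have cop : IsCoprime ((l : ℤ) ^ 2) 2 := by
      apply IsCoprime.pow_left
      rw [Int.isCoprime_iff_gcd_eq_one]
      have := (Nat.coprime_primes hlp Nat.prime_two).2 hl2
      simpa [Int.gcd] using this
    exact cop.dvd_of_dvd_mul_left e3
  obtain ⟨w, hw⟩ := H v l hl hvd hvQ
  have e4 : ∑ j, c' j • r' j = 0 := by
    apply Subtype.ext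
    have : redv l v = 0 := by rw [hw, redv_smul]; simp
    rw [hv, redv_sum] at this
    simpa [hc, hr] using this
  apply hne
  apply Subtype.ext
  funext j
  exact Fintype.linearIndependent_iff.1 hr' c' e4 j

section Abstract

variable {L : Type*} [AddCommGroup L]

lemma Qadd (B : L →ₗ[ℤ] L →ₗ[ℤ] ℤ) (Q : L → ℤ) (hs : ∀ x y, B x y = B y x)
    (hQ : ∀ x, B x x = 2 * Q x) (x y : L) : Q (x + y) = Q x + Q y + B x y := by
  have := hQ (x + y)
  simp only [map_add, LinearMap.add_apply] at this
  rw [hs y x] at this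
  linarith [hQ x, hQ y]

lemma Qsmul (B : L →ₗ[ℤ] L →ₗ[ℤ] ℤ) (Q : L → ℤ)
    (hQ : ∀ x, B x x = 2 * Q x) (c : ℤ) (x : L) : Q (c • x) = c ^ 2 * Q x := by
  have := hQ (c • x)
  simp only [map_smul, LinearMap.smul_apply, smul_eq_mul] at this
  have h2 := hQ x
  rw [h2] at this
  linarith

lemma Q_perturb (B : L →ₗ[ℤ] L →ₗ[ℤ] ℤ) (Q : L → ℤ) (hs : ∀ x y, B x y = B y x)
    (hQ : ∀ x, B x x = 2 * Q x) (c : ℤ) (x y : L) :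
    Q (x + c • y) = Q x + c * B x y + c ^ 2 * Q y := by
  rw [Qadd B Q hs hQ, Qsmul B Q hQ, map_smul, smul_eq_mul]; ring

lemma select (B : L →ₗ[ℤ] L →ₗ[ℤ] ℤ) (Q : L → ℤ) (hs : ∀ x y, B x y = B y x)
    (hQ : ∀ x, B x x = 2 * Q x) (N : Submodule ℤ L) (v2 : L) (S : Finset ℕ)
    (hS : ∀ l ∈ S, l.Prime ∧ l ≠ 2 ∧ ∃ v ∈ N, ¬ (l : ℤ) ∣ Q v) :
    ∃ t ∈ N, ∀ l ∈ S, ¬ (l : ℤ) ∣ Q (v2 + (4 : ℤ) • t) := by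
  induction S using Finset.induction_on with
  | empty => exact ⟨0, N.zero_mem, by simp⟩
  | insert l S hl ih =>
    obtain ⟨t, htN, ht⟩ := ih fun k hk => hS k (Finset.mem_insert_of_mem hk)
    obtain ⟨hlp, hl2, v, hvN, hv⟩ := hS l (Finset.mem_insert_self _ _)
    have hlp' : Prime (l : ℤ) := Nat.prime_iff_prime_int.1 hlp
    by_cases hgood : (l : ℤ) ∣ Q (v2 + (4 : ℤ) • t)
    swap
    · refine ⟨t, htN, fun k hk => ?_⟩
      rcases Finset.mem_insert.1 hk with rfl | hk
      · exact hgood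
      · exact ht k hk
    set P : ℤ := ∏ k ∈ S, (k : ℤ) with hP
    have hlP : ¬ (l : ℤ) ∣ P := by
      intro h
      rw [hP, hlp'.dvd_finsetProd_iff] at h
      obtain ⟨k, hk, hlk⟩ := h
      have hlk' : l ∣ k := by exact_mod_cast hlk
      have := (Nat.prime_dvd_prime_iff_eq hlp (hS k (Finset.mem_insert_of_mem hk)).1).1 hlk'
      exact hl (this ▸ hk)
    have hl2' : ¬ (l : ℤ) ∣ 2 := by
      intro h
      have h' : l ∣ 2 := by exact_mod_cast h
      exact hl2 ((Nat.prime_dvd_prime_iff_eq hlp Nat.prime_two).1 h')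
    set w := v2 + (4 : ℤ) • t with hw
    have key : ∀ ε : ℤ, ∀ k ∈ S, ¬ (k : ℤ) ∣ Q (w + (4 * P * ε) • v) := by
      intro ε k hk h
      apply ht k hk
      have hkP : (k : ℤ) ∣ P := Finset.dvd_prod_of_mem (fun k : ℕ => (k : ℤ)) hk
      obtain ⟨r, hr⟩ := hkP
      obtain ⟨s, hs'⟩ := h
      rw [Q_perturb B Q hs hQ] at hs'
      refine ⟨s - 4 * r * ε * B w v - (4 * ε) ^ 2 * r * P * Q v, ?_⟩
      linear_combination hs' - (4 * ε * B w v + (4 * ε) ^ 2 * P * Q v) * hr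
    have hex : ∃ ε : ℤ, ¬ (l : ℤ) ∣ Q (w + (4 * P * ε) • v) := by
      by_contra hcon
      push Not at hcon
      have h1 := hcon 1
      have h2 := hcon (-1)
      rw [Q_perturb B Q hs hQ] at h1 h2
      have h3 : (l : ℤ) ∣ 2 * 2 * 2 * 2 * 2 * P * P * Q v := by
        obtain ⟨a, ha⟩ := h1
        obtain ⟨b, hb⟩ := h2
        obtain ⟨c, hc⟩ := hgood
        exact ⟨a + b - 2 * c, by linear_combination ha + hb - 2 * hc⟩
      simp only [hlp'.dvd_mul] at h3
      tauto
    obtain ⟨ε, hε⟩ := hex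
    refine ⟨t + (P * ε) • v, N.add_mem htN (N.smul_mem _ hvN), fun k hk => ?_⟩
    have e : v2 + (4 : ℤ) • (t + (P * ε) • v) = w + (4 * P * ε) • v := by
      rw [hw, smul_add, smul_smul, add_assoc, mul_assoc]
    rw [e]
    rcases Finset.mem_insert.1 hk with rfl | hk
    · exact hε
    · exact key ε k hk

lemma select_sign (B : L →ₗ[ℤ] L →ₗ[ℤ] ℤ) (Q : L → ℤ) (hs : ∀ x y, B x y = B y x)
    (hQ : ∀ x, B x x = 2 * Q x) (N : Submodule ℤ L) (v2 : L) (S : Finset ℕ)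
    (hS : ∀ l ∈ S, l.Prime ∧ l ≠ 2 ∧ ∃ v ∈ N, ¬ (l : ℤ) ∣ Q v) (σ : ℤ)
    (u : L) (huN : u ∈ N) (hu : 0 < σ * Q u) :
    ∃ t ∈ N, (∀ l ∈ S, ¬ (l : ℤ) ∣ Q (v2 + (4 : ℤ) • t)) ∧ 0 < σ * Q (v2 + (4 : ℤ) • t) := by
  obtain ⟨t, htN, ht⟩ := select B Q hs hQ N v2 S hS
  set P : ℤ := ∏ k ∈ S, (k : ℤ) with hP
  have hP0 : 1 ≤ P := by
    rw [hP]
    have : 0 < ∏ k ∈ S, (k : ℤ) :=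
      Finset.prod_pos fun k hk => by exact_mod_cast (hS k hk).1.pos
    omega
  set w := v2 + (4 : ℤ) • t with hw
  set k : ℤ := |σ * Q w| + |σ * B w u| + 1 with hk
  have e : v2 + (4 : ℤ) • (t + (P * k) • u) = w + (4 * P * k) • u := by
    rw [hw, smul_add, smul_smul, add_assoc, mul_assoc]
  refine ⟨t + (P * k) • u, N.add_mem htN (N.smul_mem _ huN), fun l hl h => ?_, ?_⟩
  · apply ht l hl
    rw [e, Q_perturb B Q hs hQ] at h
    have hkP : (l : ℤ) ∣ P := Finset.dvd_prod_of_mem (fun k : ℕ => (k : ℤ)) hl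
    obtain ⟨r, hr⟩ := hkP
    obtain ⟨s, hs'⟩ := h
    refine ⟨s - 4 * r * k * B w u - (4 * k) ^ 2 * r * P * Q u, ?_⟩
    linear_combination hs' - (4 * k * B w u + (4 * k) ^ 2 * P * Q u) * hr
  · rw [e, Q_perturb B Q hs hQ]
    set X := 4 * P * k with hX
    have n1 := abs_nonneg (σ * Q w)
    have n2 := abs_nonneg (σ * B w u)
    have hkpos : 1 ≤ k := by omega
    have hXk : k ≤ X := by rw [hX]; nlinarith
    have b1 := neg_abs_le (σ * Q w)
    have b2 := neg_abs_le (σ * B w u)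
    have c1 : X * (-|σ * B w u|) ≤ X * (σ * B w u) :=
      mul_le_mul_of_nonneg_left b2 (by omega)
    have c2 : X ^ 2 * 1 ≤ X ^ 2 * (σ * Q u) := mul_le_mul_of_nonneg_left hu (sq_nonneg _)
    have c3 : X * (|σ * Q w| + |σ * B w u| + 1) ≤ X * X :=
      mul_le_mul_of_nonneg_left (by omega) (by omega)
    have c4 : 1 * |σ * Q w| ≤ X * |σ * Q w| := mul_le_mul_of_nonneg_right (by omega) n1
    nlinarith

lemma isotropic_of_four (B : L →ₗ[ℤ] L →ₗ[ℤ] ℤ) (Q : L → ℤ) (hs : ∀ x y, B x y = B y x)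
    (hQ : ∀ x, B x x = 2 * Q x) (x1 x2 x3 x4 : L)
    (o12 : B x1 x2 = 0) (o13 : B x1 x3 = 0) (o14 : B x1 x4 = 0) (o23 : B x2 x3 = 0)
    (o24 : B x2 x4 = 0) (o34 : B x3 x4 = 0)
    (h1 : 0 < Q x1) (h4 : Q x4 < 0) (h12 : (Q x1 * Q x2) % 4 = 3) (h34 : (Q x3 * Q x4) % 4 = 3)
    (c12 : IsCoprime (Q x1) (Q x2)) (c13 : IsCoprime (Q x1) (Q x3))
    (c14 : IsCoprime (Q x1) (Q x4)) (c23 : IsCoprime (Q x2) (Q x3))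
    (c24 : IsCoprime (Q x2) (Q x4)) (c34 : IsCoprime (Q x3) (Q x4)) :
    ∃ v, v ≠ 0 ∧ Q v = 0 := by
  obtain ⟨q, x, y, z, x', y', z', hq, hn, hn', e1, e2⟩ :=
    quaternary _ _ _ _ h1 h4 h12 h34 c12 c13 c14 c23 c24 c34
  have h2 : Q x2 ≠ 0 := by intro h; rw [h] at h12; simp at h12
  have h3 : Q x3 ≠ 0 := by intro h; rw [h] at h34; simp at h34
  have Q1 : Q (x • x1 + y • x2) = q * z ^ 2 := by
    rw [Q_perturb B Q hs hQ, Qsmul B Q hQ, map_smul, LinearMap.smul_apply, o12, ← e1]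
    simp; ring
  have Q2 : Q (x' • x3 + y' • x4) = - (q * z' ^ 2) := by
    rw [Q_perturb B Q hs hQ, Qsmul B Q hQ, map_smul, LinearMap.smul_apply, o34, ← e2]
    simp; ring
  have nz : ∀ (s t : L) (α β : ℤ), B s t = 0 → Q s ≠ 0 → Q t ≠ 0 → α • s + β • t = 0 →
      α = 0 ∧ β = 0 := by
    intro s t α β hst hs0 ht0 h
    have g1 : B s (α • s + β • t) = 0 := by rw [h, map_zero]
    have g2 : B t (α • s + β • t) = 0 := by rw [h, map_zero]
    rw [map_add, map_smul, map_smul, hst, hQ] at g1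
    rw [map_add, map_smul, map_smul, hs t s, hst, hQ] at g2
    simp [hs0] at g1
    simp [ht0] at g2
    exact ⟨g1, g2⟩
  by_cases hz : z = 0
  · refine ⟨_, fun h => ?_, by rw [Q1, hz]; ring⟩
    have := nz _ _ _ _ o12 h1.ne' h2 h
    tauto
  by_cases hz' : z' = 0
  · refine ⟨_, fun h => ?_, by rw [Q2, hz']; ring⟩
    have := nz _ _ _ _ o34 h3 h4.ne h
    tauto
  have o : B (x • x1 + y • x2) (x' • x3 + y' • x4) = 0 := by
    simp [o13, o14, o23, o24]
  set u1 := x • x1 + y • x2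
  set u2 := x' • x3 + y' • x4
  refine ⟨z' • u1 + z • u2, fun h => ?_, ?_⟩
  · have := nz u1 u2 z' z o (by rw [Q1]; positivity) (by rw [Q2]; simp [hq, hz']) h
    tauto
  · rw [Q_perturb B Q hs hQ, Qsmul B Q hQ, map_smul, LinearMap.smul_apply, o, Q1, Q2]
    simp; ring

end Abstract

lemma coprime_of_primes (m a b : ℤ) (hm : m ≠ 0) (ham : a ∣ m) (hb : b % 2 = 1)
    (h : ∀ l ∈ m.natAbs.primeFactors.erase 2, ¬ (l : ℤ) ∣ b) : IsCoprime a b := by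
  rw [Int.isCoprime_iff_gcd_eq_one]
  by_contra hg
  obtain ⟨l, hl, hlg⟩ := Nat.exists_prime_and_dvd hg
  have h1 : (l : ℤ) ∣ a := (Int.natCast_dvd_natCast.2 hlg).trans (Int.gcd_dvd_left _ _)
  have h2 : (l : ℤ) ∣ b := (Int.natCast_dvd_natCast.2 hlg).trans (Int.gcd_dvd_right _ _)
  refine h l (Finset.mem_erase.2 ⟨?_, Nat.mem_primeFactors.2 ⟨hl, ?_, by simpa using hm⟩⟩) h2
  · rintro rfl
    push_cast at h2
    omega
  · exact Int.natCast_dvd.1 (h1.trans ham)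

lemma exists_isotropic {n : ℕ} (hn : 5 ≤ n) (G : Matrix (Fin n) (Fin n) ℤ)
    (Q : (Fin n → ℤ) → ℤ) (hs : ∀ x y, BB G x y = BB G y x) (hQ : ∀ x, BB G x x = 2 * Q x)
    (d : ℤ) (hd : d ≠ 0)
    (rad0 : ∀ l : ℕ, l.Prime → ¬ (l : ℤ) ∣ d →
      finrank (ZMod l) (LinearMap.ker (BR l G)) ≤ 0)
    (rad2 : ∀ l : ℕ, l.Prime → l ≠ 2 → finrank (ZMod l) (LinearMap.ker (BR l G)) ≤ 2)
    (h2 : ∀ v, (∀ y, (2 : ℤ) ∣ BB G v y) → ∃ w, v = (2 : ℤ) • w)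
    (up un : Fin n → ℤ) (hup : 0 < Q up) (hun : Q un < 0) : ∃ v, v ≠ 0 ∧ Q v = 0 := by
  have hF2 : Fact (Nat.Prime 2) := ⟨Nat.prime_two⟩
  have rad2' : finrank (ZMod 2) (LinearMap.ker (BR 2 G)) ≤ 0 := rad_zero G h2
  have hmod : ∀ v t, Q (v + (4 : ℤ) • t) % 4 = Q v % 4 := by
    intro v t
    rw [Q_perturb (BB G) Q hs hQ]
    omega
  have hodd : ∀ v, Q v % 2 = 1 → ∃ u, BB G v u % 2 = 1 := by
    intro v hv
    by_contra hcon
    push Not at hcon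
    obtain ⟨w, rfl⟩ := h2 v fun y => by have := hcon y; omega
    rw [Qsmul (BB G) Q hQ] at hv
    omega
  have hmem : ∀ (m : ℤ) (l : ℕ), l ∈ m.natAbs.primeFactors.erase 2 →
      l.Prime ∧ l ≠ 2 ∧ (l : ℤ) ∣ m := by
    intro m l hl
    rw [Finset.mem_erase, Nat.mem_primeFactors] at hl
    exact ⟨hl.2.1, hl.1, Int.natCast_dvd.2 hl.2.2.1⟩
  have hmem' : ∀ (m : ℤ) (l : ℕ), m ≠ 0 → l.Prime → l ≠ 2 → (l : ℤ) ∣ m →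
      l ∈ m.natAbs.primeFactors.erase 2 := by
    intro m l h0 hl h2 h3
    rw [Finset.mem_erase, Nat.mem_primeFactors]
    exact ⟨h2, hl, Int.natCast_dvd.1 h3, by simpa using h0⟩
  have hB : ∀ (l : ℕ) v, l.Prime → l ≠ 2 → ¬ (l : ℤ) ∣ Q v → ¬ (l : ℤ) ∣ BB G v v := by
    intro l v hl hl2 hv h
    rw [hQ, (Nat.prime_iff_prime_int.1 hl).dvd_mul] at h
    rcases h with h | h
    · have h' : l ∣ 2 := by exact_mod_cast h
      exact hl2 ((Nat.prime_dvd_prime_iff_eq hl Nat.prime_two).1 h')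
    · exact hv h
  -- the vector x
  obtain ⟨x0, -, hx0⟩ := exists_unit_value 2 G Q hs hQ (i := 0) Fin.elim0 (fun j => j.elim0) ∅
    (by simp) 0 rad2' (by omega)
  obtain ⟨tx, -, hxS, hxpos⟩ := select_sign (BB G) Q hs hQ ⊤ x0 (d.natAbs.primeFactors.erase 2)
    (fun l hl => by
      obtain ⟨hl1, hl2, hl3⟩ := hmem _ _ hl
      have : Fact l.Prime := ⟨hl1⟩
      obtain ⟨v, -, hv⟩ := exists_unit_value l G Q hs hQ (i := 0) Fin.elim0 (fun j => j.elim0) ∅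
        (by simp) 2 (rad2 l hl1 hl2) (by omega)
      exact ⟨hl1, hl2, v, trivial, hv⟩) 1 up trivial (by simpa using hup)
  have hxodd : Q (x0 + (4 : ℤ) • tx) % 2 = 1 := by
    have := hmod x0 tx
    push_cast at hx0
    omega
  generalize x0 + (4 : ℤ) • tx = x at *
  rw [one_mul] at hxpos
  -- the vector y
  obtain ⟨f, hf⟩ := hodd x hxodd
  set y0 := (BB G x f) • x - (BB G x x) • f with hy0
  have hy0x : BB G x y0 = 0 := by
    rw [hy0, map_sub, map_smul, map_smul, smul_eq_mul, smul_eq_mul]; ring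
  have hda : d * Q x ≠ 0 := mul_ne_zero hd hxpos.ne'
  obtain ⟨ty, htyN, hyS, hyneg⟩ := select_sign (BB G) Q hs hQ (LinearMap.ker (BB G x)) y0
    ((d * Q x).natAbs.primeFactors.erase 2)
    (fun l hl => by
      obtain ⟨hl1, hl2, hl3⟩ := hmem _ _ hl
      have : Fact l.Prime := ⟨hl1⟩
      refine ⟨hl1, hl2, ?_⟩
      by_cases hld : (l : ℤ) ∣ d
      · obtain ⟨v, hv1, hv⟩ := exists_unit_value l G Q hs hQ (i := 1) ![x]
          (fun j k h => absurd (Subsingleton.elim j k) h) Finset.univ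
          (by
            intro j _
            fin_cases j
            exact hB l x hl1 hl2 (hxS l (hmem' _ _ hd hl1 hl2 hld)))
          2 (rad2 l hl1 hl2) (by simp; omega)
        exact ⟨v, hv1 0, hv⟩
      · obtain ⟨v, hv1, hv⟩ := exists_unit_value l G Q hs hQ (i := 1) ![x]
          (fun j k h => absurd (Subsingleton.elim j k) h) ∅ (by simp) 0 (rad0 l hl1 hld)
          (by omega)
        exact ⟨v, hv1 0, hv⟩) (-1)
    ((2 * Q x) • un + (-(BB G x un)) • x)
    (by
      rw [LinearMap.mem_ker, map_add, map_smul, map_smul, hQ, smul_eq_mul, smul_eq_mul]; ring)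
    (by
      rw [Q_perturb (BB G) Q hs hQ, Qsmul (BB G) Q hQ, map_smul, LinearMap.smul_apply, hs un x,
        smul_eq_mul]
      have p1 : 0 < Q x ^ 2 * (- Q un) := by
        have : 0 < - Q un := by omega
        positivity
      have p2 : 0 ≤ (BB G x un) ^ 2 * Q x := by positivity
      nlinarith)
  have htyN' : BB G x ty = 0 := htyN
  have hyx : BB G x (y0 + (4 : ℤ) • ty) = 0 := by
    rw [map_add, map_smul, hy0x, htyN']; simp
  have hy4 : (Q (y0 + (4 : ℤ) • ty) + Q x) % 4 = 0 := by
    have h1 := hmod y0 ty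
    have h3 : Q y0 = - Q x * (BB G x f) ^ 2 + 4 * (Q x ^ 2 * Q f) := by
      have : y0 = (BB G x f) • x + (-(BB G x x)) • f := by rw [hy0, neg_smul, sub_eq_add_neg]
      rw [this, Q_perturb (BB G) Q hs hQ, Qsmul (BB G) Q hQ, map_smul, LinearMap.smul_apply, hQ,
        smul_eq_mul]
      ring
    obtain ⟨s, hs'⟩ : ∃ s, BB G x f = 2 * s + 1 := ⟨BB G x f / 2, by omega⟩
    have h4 : Q y0 = - Q x + 4 * (Q x ^ 2 * Q f - Q x * (s ^ 2 + s)) := by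
      rw [h3, hs']; ring
    omega
  obtain ⟨k0, hk0⟩ : ∃ k0, y0 + (4 : ℤ) • ty = x + (2 : ℤ) • k0 := by
    obtain ⟨s, hs'⟩ : ∃ s, BB G x f = 2 * s + 1 := ⟨BB G x f / 2, by omega⟩
    refine ⟨s • x - (Q x) • f + (2 : ℤ) • ty, ?_⟩
    rw [hy0, hs', hQ]
    module
  generalize y0 + (4 : ℤ) • ty = y at *
  have hyneg' : Q y < 0 := by omega
  -- the vector z
  have hdab : d * Q x * Q y ≠ 0 := mul_ne_zero hda hyneg'.ne
  have hcl : ∀ l : ℕ, l.Prime → (l : ℤ) ∣ d * Q x → l ≠ 2 → ¬ (l : ℤ) ∣ Q y :=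
    fun l h1 h3 h4 => hyS l (hmem' _ _ hda h1 h4 h3)
  have orth2 : ∀ j k : Fin 2, j ≠ k → BB G (![x, y] j) (![x, y] k) = 0 := by
    intro j k hjk
    fin_cases j <;> fin_cases k <;> simp at hjk ⊢
    · exact hyx
    · rw [hs]; exact hyx
  obtain ⟨z0, hz0N, hz0⟩ := exists_unit_value 2 G Q hs hQ (i := 2) ![x, y] orth2 ∅
    (by simp) 0 rad2' (by omega)
  obtain ⟨tz, htzN, hzS⟩ := select (BB G) Q hs hQ
    (LinearMap.ker (BB G x) ⊓ LinearMap.ker (BB G y)) z0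
    ((d * Q x * Q y).natAbs.primeFactors.erase 2)
    (fun l hl => by
      obtain ⟨hl1, hl2, hl3⟩ := hmem _ _ hl
      have : Fact l.Prime := ⟨hl1⟩
      refine ⟨hl1, hl2, ?_⟩
      by_cases hld : (l : ℤ) ∣ d
      · obtain ⟨v, hv1, hv⟩ := exists_unit_value l G Q hs hQ (i := 2) ![x, y]
          orth2 Finset.univ
          (by
            intro j _
            fin_cases j
            · exact hB l x hl1 hl2 (hxS l (hmem' _ _ hd hl1 hl2 hld))
            · exact hB l y hl1 hl2 (hcl l hl1 (hld.mul_right _) hl2))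
          2 (rad2 l hl1 hl2) (by simp; omega)
        exact ⟨v, ⟨hv1 0, hv1 1⟩, hv⟩
      · obtain ⟨v, hv1, hv⟩ := exists_unit_value l G Q hs hQ (i := 2) ![x, y]
          orth2 ∅ (by simp) 0 (rad0 l hl1 hld) (by omega)
        exact ⟨v, ⟨hv1 0, hv1 1⟩, hv⟩)
  have hzx : BB G x (z0 + (4 : ℤ) • tz) = 0 := by
    have e1 : BB G x z0 = 0 := hz0N 0
    have e2 : BB G x tz = 0 := htzN.1
    rw [map_add, map_smul, e1, e2]; simp
  have hzy : BB G y (z0 + (4 : ℤ) • tz) = 0 := by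
    have e1 : BB G y z0 = 0 := hz0N 1
    have e2 : BB G y tz = 0 := htzN.2
    rw [map_add, map_smul, e1, e2]; simp
  have hzodd : Q (z0 + (4 : ℤ) • tz) % 2 = 1 := by
    have := hmod z0 tz
    push_cast at hz0
    omega
  generalize z0 + (4 : ℤ) • tz = z at *
  have hz00 : Q z ≠ 0 := by intro h; rw [h] at hzodd; simp at hzodd
  -- the vector w
  obtain ⟨u, hu⟩ := hodd z hzodd
  have hzk : BB G z k0 = 0 := by
    rw [hk0, map_add, LinearMap.add_apply, hzx, map_smul, LinearMap.smul_apply] at hzy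
    rw [hs]
    simpa using hzy
  have hxk : BB G x k0 = - Q x := by
    rw [hk0, map_add, map_smul, hQ, smul_eq_mul] at hyx
    omega
  obtain ⟨g, hgx, hgy, hgz⟩ : ∃ g, BB G x g = 0 ∧ BB G y g = 0 ∧ BB G z g % 2 = 1 := by
    set D := BB G x x * BB G k0 k0 - BB G x k0 ^ 2 with hD
    set α := BB G x u * BB G k0 k0 - BB G k0 u * BB G x k0 with hα
    set β := BB G k0 u * BB G x x - BB G x u * BB G x k0 with hβ
    have gx : BB G x (D • u + (-α) • x + (-β) • k0) = 0 := by
      simp only [map_add, map_smul, smul_eq_mul]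
      rw [hD, hα, hβ]; ring
    have gk : BB G k0 (D • u + (-α) • x + (-β) • k0) = 0 := by
      simp only [map_add, map_smul, smul_eq_mul]
      rw [hs k0 x, hD, hα, hβ]; ring
    refine ⟨D • u + (-α) • x + (-β) • k0, gx, ?_, ?_⟩
    · generalize D • u + (-α) • x + (-β) • k0 = g at gx gk
      rw [hk0, map_add, LinearMap.add_apply, gx, map_smul, LinearMap.smul_apply, gk]; simp
    · simp only [map_add, map_smul, smul_eq_mul]
      rw [hzk, hs z x, hzx]
      have hDodd : D % 2 = 1 := by
        rw [hD, hQ, hxk]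
        obtain ⟨s, hs'⟩ : ∃ s, Q x = 2 * s + 1 := ⟨Q x / 2, by omega⟩
        have : 2 * Q x * BB G k0 k0 - (- Q x) ^ 2 =
            2 * (Q x * BB G k0 k0 - 2 * s ^ 2 - 2 * s - 1) + 1 := by rw [hs']; ring
        omega
      simp [Int.mul_emod, hDodd, hu]
  set w0 := (BB G z g) • z - (BB G z z) • g with hw0
  have hw0x : BB G x w0 = 0 := by rw [hw0, map_sub, map_smul, map_smul, hzx, hgx]; simp
  have hw0y : BB G y w0 = 0 := by rw [hw0, map_sub, map_smul, map_smul, hzy, hgy]; simp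
  have hw0z : BB G z w0 = 0 := by
    rw [hw0, map_sub, map_smul, map_smul, smul_eq_mul, smul_eq_mul]; ring
  have orth3 : ∀ j k : Fin 3, j ≠ k → BB G (![x, y, z] j) (![x, y, z] k) = 0 := by
    intro j k hjk
    fin_cases j <;> fin_cases k <;> simp at hjk ⊢
    · exact hyx
    · exact hzx
    · rw [hs]; exact hyx
    · exact hzy
    · rw [hs]; exact hzx
    · rw [hs]; exact hzy
  have hclz : ∀ l : ℕ, l.Prime → (l : ℤ) ∣ d * Q x * Q y → l ≠ 2 → ¬ (l : ℤ) ∣ Q z :=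
    fun l h1 h3 h4 => hzS l (hmem' _ _ hdab h1 h4 h3)
  have habc : Q x * Q y * Q z ≠ 0 := mul_ne_zero (mul_ne_zero hxpos.ne' hyneg'.ne) hz00
  obtain ⟨tw, htwN, hwS⟩ := select (BB G) Q hs hQ
    (LinearMap.ker (BB G x) ⊓ LinearMap.ker (BB G y) ⊓ LinearMap.ker (BB G z)) w0
    ((Q x * Q y * Q z).natAbs.primeFactors.erase 2)
    (fun l hl => by
      obtain ⟨hl1, hl2, hl3⟩ := hmem _ _ hl
      have : Fact l.Prime := ⟨hl1⟩
      refine ⟨hl1, hl2, ?_⟩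
      have hlp := Nat.prime_iff_prime_int.1 hl1
      have hld : ¬ (l : ℤ) ∣ d := by
        intro hld
        rw [hlp.dvd_mul, hlp.dvd_mul] at hl3
        rcases hl3 with (h | h) | h
        · exact hxS l (hmem' _ _ hd hl1 hl2 hld) h
        · exact hcl l hl1 (hld.mul_right _) hl2 h
        · exact hclz l hl1 ((hld.mul_right _).mul_right _) hl2 h
      have fin : ∀ J : Finset (Fin 3), J.card = 2 →
          (∀ j ∈ J, ¬ (l : ℤ) ∣ Q (![x, y, z] j)) →
          ∃ v ∈ LinearMap.ker (BB G x) ⊓ LinearMap.ker (BB G y) ⊓ LinearMap.ker (BB G z),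
            ¬ (l : ℤ) ∣ Q v := by
        intro J hJ hJ'
        obtain ⟨v, hv1, hv⟩ := exists_unit_value l G Q hs hQ (i := 3) ![x, y, z]
          orth3 J (fun j hj => hB l _ hl1 hl2 (hJ' j hj)) 0 (rad0 l hl1 hld) (by omega)
        exact ⟨v, ⟨⟨hv1 0, hv1 1⟩, hv1 2⟩, hv⟩
      by_cases hx : (l : ℤ) ∣ Q x
      · have hy := hcl l hl1 (hx.mul_left _) hl2
        have hz := hclz l hl1 ((hx.mul_left _).mul_right _) hl2
        exact fin {1, 2} (by decide) (by simpa using ⟨hy, hz⟩)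
      · by_cases hy : (l : ℤ) ∣ Q y
        · have hz := hclz l hl1 (hy.mul_left _) hl2
          exact fin {0, 2} (by decide) (by simpa using ⟨hx, hz⟩)
        · exact fin {0, 1} (by decide) (by simpa using ⟨hx, hy⟩))
  have hwx : BB G x (w0 + (4 : ℤ) • tw) = 0 := by
    have e2 : BB G x tw = 0 := htwN.1.1
    rw [map_add, map_smul, hw0x, e2]; simp
  have hwy : BB G y (w0 + (4 : ℤ) • tw) = 0 := by
    have e2 : BB G y tw = 0 := htwN.1.2
    rw [map_add, map_smul, hw0y, e2]; simp
  have hwz : BB G z (w0 + (4 : ℤ) • tw) = 0 := by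
    have e2 : BB G z tw = 0 := htwN.2
    rw [map_add, map_smul, hw0z, e2]; simp
  have hw4 : (Q (w0 + (4 : ℤ) • tw) + Q z) % 4 = 0 := by
    have h1 := hmod w0 tw
    have h3 : Q w0 = - Q z * (BB G z g) ^ 2 + 4 * (Q z ^ 2 * Q g) := by
      have : w0 = (BB G z g) • z + (-(BB G z z)) • g := by rw [hw0, neg_smul, sub_eq_add_neg]
      rw [this, Q_perturb (BB G) Q hs hQ, Qsmul (BB G) Q hQ, map_smul, LinearMap.smul_apply, hQ,
        smul_eq_mul]
      ring
    obtain ⟨s, hs'⟩ : ∃ s, BB G z g = 2 * s + 1 := ⟨BB G z g / 2, by omega⟩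
    have h4 : Q w0 = - Q z + 4 * (Q z ^ 2 * Q g - Q z * (s ^ 2 + s)) := by
      rw [h3, hs']; ring
    omega
  generalize w0 + (4 : ℤ) • tw = w at *
  have hwodd : Q w % 2 = 1 := by omega
  have hyodd : Q y % 2 = 1 := by omega
  have cxy := coprime_of_primes _ (Q x) (Q y) hda (Dvd.intro_left _ rfl) hyodd hyS
  have cxz := coprime_of_primes _ (Q x) (Q z) hdab ⟨d * Q y, by ring⟩ hzodd hzS
  have cyz := coprime_of_primes _ (Q y) (Q z) hdab ⟨d * Q x, by ring⟩ hzodd hzS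
  have cxw := coprime_of_primes _ (Q x) (Q w) habc ⟨Q y * Q z, by ring⟩ hwodd hwS
  have cyw := coprime_of_primes _ (Q y) (Q w) habc ⟨Q x * Q z, by ring⟩ hwodd hwS
  have czw := coprime_of_primes _ (Q z) (Q w) habc ⟨Q x * Q y, by ring⟩ hwodd hwS
  have m4 : ∀ α β : ℤ, α % 2 = 1 → (β + α) % 4 = 0 → (α * β) % 4 = 3 := by
    intro α β h1 h3
    have : α % 4 = 1 ∧ β % 4 = 3 ∨ α % 4 = 3 ∧ β % 4 = 1 := by omega
    rcases this with ⟨h, h'⟩ | ⟨h, h'⟩ <;> simp [Int.mul_emod, h, h']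
  by_cases hcase : (Q z + Q x) % 4 = 0
  · exact isotropic_of_four (BB G) Q hs hQ x z w y hzx hwx hyx hwz (by rw [hs]; exact hzy)
      (by rw [hs]; exact hwy) hxpos hyneg' (m4 _ _ hxodd hcase)
      (m4 _ _ hwodd (by omega)) cxz cxw cxy czw cyz.symm cyw.symm
  · exact isotropic_of_four (BB G) Q hs hQ x w z y hwx hzx hyx (by rw [hs]; exact hwz)
      (by rw [hs]; exact hwy) (by rw [hs]; exact hzy) hxpos hyneg' (m4 _ _ hxodd (by omega))
      (m4 _ _ hzodd (by omega)) cxw cxz cxy czw.symm cyw.symm cyz.symm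

lemma castBB {K : Type*} [Field K] {n : ℕ} (G : Matrix (Fin n) (Fin n) ℤ) (x y : Fin n → ℤ) :
    dotProduct (fun i => (x i : K)) ((G.map (Int.cast : ℤ → K)).mulVec (fun i => (y i : K))) =
      ((BB G x y : ℤ) : K) := by
  simp [BB_apply, dotProduct, Matrix.mulVec]

lemma BB_symm {n : ℕ} (G : Matrix (Fin n) (Fin n) ℤ) (h : G.IsSymm) (x y : Fin n → ℤ) :
    BB G x y = BB G y x := by
  rw [BB_apply, BB_apply, Matrix.dotProduct_mulVec, dotProduct_comm, ← Matrix.mulVec_transpose,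
    h.eq]

lemma BB_even {n : ℕ} (G : Matrix (Fin n) (Fin n) ℤ) (h : G.IsSymm) (he : ∀ i, Even (G i i))
    (x : Fin n → ℤ) : Even (BB G x x) := by
  have key : (fun v => Even (BB G v v))
      (∑ i, x i • fun j => if i = j then (1 : ℤ) else 0) := by
    refine Finset.sum_induction (M := Fin n → ℤ) _ (fun v => Even (BB G v v)) ?_ ?_ ?_
    · intro a b ha hb
      simp only [map_add, LinearMap.add_apply]
      rw [BB_symm G h b a]
      obtain ⟨r, hr⟩ := ha
      obtain ⟨s, hs⟩ := hb
      exact ⟨r + s + BB G a b, by rw [hr, hs]; ring⟩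
    · simp
    · intro i _
      have : BB G (fun j => if i = j then (1 : ℤ) else 0) (fun j => if i = j then (1 : ℤ) else 0)
          = G i i := by
        simp [BB_apply, dotProduct, Matrix.mulVec]
      simp only [map_smul, LinearMap.smul_apply, smul_eq_mul, this]
      exact ((he i).mul_left _).mul_left _
  rw [← pi_eq_sum_univ x] at key
  exact key

lemma int_approx {n : ℕ} (G : Matrix (Fin n) (Fin n) ℤ) (s : ℤ) (u : Fin n → ℝ)
    (hu : 0 < (s : ℝ) * dotProduct u ((G.map (Int.cast : ℤ → ℝ)).mulVec u)) :
    ∃ v : Fin n → ℤ, 0 < s * BB G v v := by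
  have hc : Continuous fun u : Fin n → ℝ =>
      (s : ℝ) * dotProduct u ((G.map (Int.cast : ℤ → ℝ)).mulVec u) := by
    simp only [dotProduct, Matrix.mulVec]
    fun_prop
  have hd : DenseRange (Pi.map fun (_ : Fin n) => ((↑) : ℚ → ℝ)) :=
    DenseRange.piMap fun _ => Rat.denseRange_cast
  obtain ⟨q, hq⟩ := hd.exists_mem_open (isOpen_lt continuous_const hc) ⟨u, hu⟩
  simp only [Set.mem_ofPred_eq] at hq
  set D : ℕ := ∏ j, (q j).den with hD
  have hD0 : 0 < D := Finset.prod_pos fun j _ => (q j).den_pos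
  have : ∀ i, ∃ z : ℤ, (z : ℝ) = D * (q i : ℝ) := by
    intro i
    obtain ⟨c, hc⟩ : (q i).den ∣ D := Finset.dvd_prod_of_mem (fun j => (q j).den) (Finset.mem_univ i)
    refine ⟨c * (q i).num, ?_⟩
    have h := Rat.den_mul_eq_num (q i)
    have h' : ((q i).den : ℝ) * (q i : ℝ) = ((q i).num : ℝ) := by exact_mod_cast h
    rw [hc]; push_cast; rw [← h']; ring
  choose v hv using this
  refine ⟨v, ?_⟩
  have e : (fun i => (v i : ℝ)) = (D : ℝ) • (Pi.map (fun (_ : Fin n) => ((↑) : ℚ → ℝ)) q) := by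
    ext i; simp [hv]
  have h := castBB (K := ℝ) G v v
  rw [e, Matrix.mulVec_smul, smul_dotProduct, dotProduct_smul, smul_eq_mul, smul_eq_mul] at h
  have : (0 : ℝ) < ((s * BB G v v : ℤ) : ℝ) := by
    push_cast
    rw [← h]
    have hD0' : (0 : ℝ) < D := by exact_mod_cast hD0
    have := mul_pos (mul_pos hD0' hD0') hq
    linarith
  exact_mod_cast this

lemma BB_single {n : ℕ} (G : Matrix (Fin n) (Fin n) ℤ) (h : G.IsSymm) (v : Fin n → ℤ) (i : Fin n) :
    BB G v (Pi.single i 1) = G.mulVec v i := by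
  rw [BB_symm G h, BB_apply]; simp

lemma adj_eq {n : ℕ} (G : Matrix (Fin n) (Fin n) ℤ) (v : Fin n → ℤ) (i : Fin n) :
    G.det * v i = ∑ j, G.adjugate i j * G.mulVec v j := by
  have : G.adjugate.mulVec (G.mulVec v) = G.det • v := by
    rw [Matrix.mulVec_mulVec, Matrix.adjugate_mul, Matrix.smul_mulVec, Matrix.one_mulVec]
  have := congrFun this i
  simp only [Pi.smul_apply, smul_eq_mul] at this
  rw [← this]; rfl

open Matrix

theorem anisotropic_splits_hyperbolic_plane
    (p : ℕ) (hp : 3 ≤ p)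
    (G : Matrix (Fin (p + 2)) (Fin (p + 2)) ℤ)
    (hsymm : G.IsSymm)
    (heven : ∀ i, Even (G i i))
    -- signature (p, 2)
    (hsig : ∃ P : Matrix (Fin (p + 2)) (Fin (p + 2)) ℝ, IsUnit P.det ∧
      Pᵀ * G.map (Int.cast : ℤ → ℝ) * P =
        Matrix.diagonal (fun i : Fin (p + 2) => if (i : ℕ) < p then (1 : ℝ) else -1))
    -- the discriminant group A = L'/L is anisotropic:
    -- any x ∈ L' with Q(x) ∈ ℤ lies in L
    (haniso : ∀ x : Fin (p + 2) → ℚ,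
      (∀ y : Fin (p + 2) → ℤ, ∃ k : ℤ,
        dotProduct x ((G.map (Int.cast : ℤ → ℚ)).mulVec (fun i => (y i : ℚ))) = k) →
      (∃ k : ℤ, dotProduct x ((G.map (Int.cast : ℤ → ℚ)).mulVec x) / 2 = k) →
      ∃ v : Fin (p + 2) → ℤ, x = fun i => (v i : ℚ)) 
    -- the level of the lattice is odd
    (hlevel : ∃ N : ℕ, Odd N ∧ 0 < N ∧ ∀ x : Fin (p + 2) → ℚ,
      (∀ y : Fin (p + 2) → ℤ, ∃ k : ℤ,
        dotProduct x ((G.map (Int.cast : ℤ → ℚ)).mulVec (fun i => (y i : ℚ))) = k) →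
      ∃ k : ℤ, (N : ℚ) * (dotProduct x ((G.map (Int.cast : ℤ → ℚ)).mulVec x) / 2) = k) :
    ∃ e f : Fin (p + 2) → ℤ,
      dotProduct e (G.mulVec e) = 0 ∧
      dotProduct f (G.mulVec f) = 0 ∧
      dotProduct e (G.mulVec f) = 1 := by
  have hs := BB_symm G hsymm
  obtain ⟨Q, hQ⟩ : ∃ Q : (Fin (p + 2) → ℤ) → ℤ, ∀ x, BB G x x = 2 * Q x := by
    have : ∀ x, ∃ q, BB G x x = 2 * q := fun x => by
      obtain ⟨r, hr⟩ := BB_even G hsymm heven x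
      exact ⟨r, by omega⟩
    choose Q hQ using this
    exact ⟨Q, hQ⟩
  have ediv : ∀ (v : Fin (p + 2) → ℤ) (m : ℤ),
      (fun i => (v i : ℚ) / m) = ((m : ℚ)⁻¹) • (fun i => (v i : ℚ)) := by
    intro v m; ext i; simp [div_eq_inv_mul]
  have edual : ∀ (v : Fin (p + 2) → ℤ) (m : ℤ), m ≠ 0 → (∀ y, m ∣ BB G v y) →
      ∀ y : Fin (p + 2) → ℤ, ∃ k : ℤ, dotProduct (fun i => (v i : ℚ) / m)
        ((G.map (Int.cast : ℤ → ℚ)).mulVec (fun i => (y i : ℚ))) = k := by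
    intro v m hm h y
    obtain ⟨k, hk⟩ := h y
    refine ⟨k, ?_⟩
    have hm' : (m : ℚ) ≠ 0 := by exact_mod_cast hm
    rw [ediv, smul_dotProduct, castBB, hk, smul_eq_mul]
    push_cast
    field_simp
  have eQ : ∀ (v : Fin (p + 2) → ℤ) (m : ℤ), dotProduct (fun i => (v i : ℚ) / m)
        ((G.map (Int.cast : ℤ → ℚ)).mulVec (fun i => (v i : ℚ) / m)) / 2
        = (Q v : ℚ) / (m : ℚ) ^ 2 := by
    intro v m
    rw [ediv, mulVec_smul, smul_dotProduct, dotProduct_smul, castBB, hQ, smul_eq_mul, smul_eq_mul]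
    push_cast
    ring
  have H : ∀ (v : Fin (p + 2) → ℤ) (m : ℤ), m ≠ 0 → (∀ y, m ∣ BB G v y) → m ^ 2 ∣ Q v →
      ∃ w, v = m • w := by
    intro v m hm h1 h2
    have hm' : (m : ℚ) ≠ 0 := by exact_mod_cast hm
    obtain ⟨w, hw⟩ := haniso (fun i => (v i : ℚ) / m) (edual v m hm h1) (by
      obtain ⟨k, hk⟩ := h2
      refine ⟨k, ?_⟩
      rw [eQ, hk]
      push_cast
      field_simp)
    refine ⟨w, ?_⟩
    ext i
    have := congrFun hw i
    rw [div_eq_iff hm'] at this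
    simp only [Pi.smul_apply, smul_eq_mul]
    have h3 : v i = w i * m := by exact_mod_cast this
    rw [h3, mul_comm]
  have h2 : ∀ v, (∀ y, (2 : ℤ) ∣ BB G v y) → ∃ w, v = (2 : ℤ) • w := by
    intro v hv
    apply H v 2 two_ne_zero hv
    obtain ⟨N, hN, -, hl⟩ := hlevel
    obtain ⟨k, hk⟩ := hl _ (edual v 2 two_ne_zero hv)
    rw [eQ] at hk
    have h4 : (N : ℤ) * Q v = 2 ^ 2 * k := by
      have : (N : ℚ) * Q v = 2 ^ 2 * k := by
        rw [← hk]; push_cast; ring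
      exact_mod_cast this
    have hco : IsCoprime ((2 : ℤ) ^ 2) (N : ℤ) := by
      apply IsCoprime.pow_left
      have : Nat.Coprime 2 N := (Nat.coprime_two_left).2 hN
      exact_mod_cast Nat.isCoprime_iff_coprime.2 this
    exact hco.dvd_of_dvd_mul_left ⟨k, h4⟩
  obtain ⟨P, -, hPG⟩ := hsig
  have hdet : G.det ≠ 0 := by
    intro h0
    have h := congrArg Matrix.det hPG
    have h1 : (G.map (Int.cast : ℤ → ℝ)).det = 0 := by
      have := (Int.castRingHom ℝ).map_det G
      rw [h0] at this
      simpa using this.symm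
    rw [det_mul, det_mul, h1, det_diagonal] at h
    have h3 : (∏ i : Fin (p + 2), if (i : ℕ) < p then (1 : ℝ) else -1) ≠ 0 := by
      apply Finset.prod_ne_zero_iff.2
      intro i _
      split_ifs <;> norm_num
    apply h3
    rw [← h]; ring
  have hcol : ∀ j : Fin (p + 2), dotProduct (fun i => P i j)
      ((G.map (Int.cast : ℤ → ℝ)).mulVec (fun i => P i j)) =
        if (j : ℕ) < p then (1 : ℝ) else -1 := by
    intro j
    have h := congrFun (congrFun hPG j) j
    rw [diagonal_apply_eq, Matrix.mul_assoc] at h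
    rw [← h]; rfl
  obtain ⟨up, hup⟩ : ∃ v, 0 < Q v := by
    obtain ⟨v, hv⟩ := int_approx G 1 (fun i => P i ⟨0, by omega⟩) (by
      rw [hcol, if_pos (by simp; omega)]; norm_num)
    exact ⟨v, by have := hQ v; omega⟩
  obtain ⟨un, hun⟩ : ∃ v, Q v < 0 := by
    obtain ⟨v, hv⟩ := int_approx G (-1) (fun i => P i ⟨p, by omega⟩) (by
      rw [hcol, if_neg (by simp)]; norm_num)
    exact ⟨v, by have := hQ v; omega⟩
  have rad0 : ∀ l : ℕ, ∀ _ : l.Prime, ¬ (l : ℤ) ∣ G.det → ∀ v, (∀ y, (l : ℤ) ∣ BB G v y) →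
      ∃ w, v = (l : ℤ) • w := by
    intro l hl hld v hv
    have hlp : Prime (l : ℤ) := Nat.prime_iff_prime_int.1 hl
    have : ∀ i, ∃ c, v i = (l : ℤ) * c := by
      intro i
      have h1 : (l : ℤ) ∣ G.det * v i := by
        rw [adj_eq]
        refine Finset.dvd_sum fun j _ => Dvd.dvd.mul_left ?_ _
        rw [← BB_single G hsymm]
        exact hv _
      exact (hlp.dvd_or_dvd h1).resolve_left hld
    choose w hw using this
    exact ⟨w, by ext i; simp [hw]⟩
  obtain ⟨e0, he0, hQe0⟩ := exists_isotropic (by omega) G Q hs hQ G.det hdet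
    (fun l hl hld => by
      have : Fact l.Prime := ⟨hl⟩
      exact rad_zero G (rad0 l hl hld))
    (fun l hl hl2 => by
      have : Fact l.Prime := ⟨hl⟩
      exact rad_two hl2 G Q hQ H) h2 up un hup hun
  obtain ⟨m, hm⟩ := (IsPrincipalIdealRing.principal (LinearMap.range (BB G e0))).principal
  obtain ⟨f0, hf0⟩ : m ∈ LinearMap.range (BB G e0) := by
    rw [hm]; exact Submodule.mem_span_singleton_self m
  have hdvd : ∀ y, m ∣ BB G e0 y := by
    intro y
    have : BB G e0 y ∈ LinearMap.range (BB G e0) := ⟨y, rfl⟩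
    rw [hm] at this
    exact Ideal.mem_span_singleton.1 this
  have hm0 : m ≠ 0 := by
    rintro rfl
    apply he0
    ext i
    have h1 : G.det * e0 i = 0 := by
      rw [adj_eq]
      refine Finset.sum_eq_zero fun j _ => ?_
      rw [← BB_single G hsymm, zero_dvd_iff.1 (hdvd _), mul_zero]
    exact (mul_eq_zero.1 h1).resolve_left hdet
  obtain ⟨w, hw⟩ := H e0 m hm0 hdvd (by rw [hQe0]; exact dvd_zero _)
  have hQw : Q w = 0 := by
    rw [hw, Qsmul (BB G) Q hQ] at hQe0
    exact (mul_eq_zero.1 hQe0).resolve_left (pow_ne_zero 2 hm0)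
  have hwf : BB G w f0 = 1 := by
    rw [hw, map_smul, LinearMap.smul_apply, smul_eq_mul] at hf0
    exact mul_left_cancel₀ hm0 (by rw [hf0, mul_one])
  have hww : BB G w w = 0 := by rw [hQ, hQw, mul_zero]
  refine ⟨w, f0 + (-Q f0) • w, ?_, ?_, ?_⟩
  · rw [← BB_apply, hww]
  · rw [← BB_apply, hQ, Q_perturb (BB G) Q hs hQ, hs f0 w, hwf, hQw]; ring
  · rw [← BB_apply, map_add, map_smul, hwf, hww]; simp
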